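/- arXiv:1105.5401 — 3 statements merged into one kernel-verified Lean document; each statement's English description precedes it below -/
import Mathlib

section
/- Let v₀, v₁, v₂, v₃, v₄, v₅ be the vertices, in cyclic order, of a convex hexagon in the Euclidean plane all of whose six sides have length 1. Then each main diagonal connecting opposite vertices has length at least 1: dist(v₀, v₃) ≥ 1, dist(v₁, v₄) ≥ 1, and dist(v₂, v₅) ≥ 1. -/
/-- The plane ℝ². -/
local notation "Plane" => EuclideanSpace ℝ (Fin 2)

/-- `ccw a b c` means the triple `(a, b, c)` is in strictly counterclockwise
(positive) orientation, i.e. `c` lies strictly to the left of the directed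
line from `a` to `b`. -/
def ccw (a b c : EuclideanSpace ℝ (Fin 2)) : Prop :=
  0 < (b 0 - a 0) * (c 1 - a 1) - (b 1 - a 1) * (c 0 - a 0)

/-- In a quadrilateral `0, a, d + b, d` with unit vectors `a`, `b` along its legs, unit top side
`d + b - a` and base `d` shorter than `1`, the angles at the base sum to more than `π`. -/
lemma cross_legs_pos_of_short_base {a₁ a₂ b₁ b₂ d₁ d₂ : ℝ}
    (ha : a₁ ^ 2 + a₂ ^ 2 = 1) (hb : b₁ ^ 2 + b₂ ^ 2 = 1)
    (htop : (d₁ + b₁ - a₁) ^ 2 + (d₂ + b₂ - a₂) ^ 2 = 1) (hd : d₁ ^ 2 + d₂ ^ 2 < 1)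
    (had : 0 < a₁ * d₂ - a₂ * d₁)
    (hleft : 0 < a₁ * (d₂ + b₂) - a₂ * (d₁ + b₁))
    (hright : 0 < b₁ * (d₂ - a₂) - b₂ * (d₁ - a₁)) :
    0 < a₁ * b₂ - a₂ * b₁ := by
  by_contra! hS
  set S := -(a₁ * b₂ - a₂ * b₁) with hSdef
  set K := -(a₁ * b₁ + a₂ * b₂) with hKdef
  set M := (a₁ - b₁) * d₁ + (a₂ - b₂) * d₂ with hMdef
  set T := (a₁ * d₂ - a₂ * d₁) + (b₁ * d₂ - b₂ * d₁) with hTdef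
  have hS0 : 0 ≤ S := by linarith
  have hTS : 2 * S < T := by linarith
  have hdiff : (a₁ - b₁) ^ 2 + (a₂ - b₂) ^ 2 = 2 * (1 + K) := by linarith
  have hK : 0 ≤ 1 + K := by linarith [sq_nonneg (a₁ - b₁), sq_nonneg (a₂ - b₂)]
  have hMS : M * S = T * (1 + K) := by
    linear_combination (b₁ * d₂ - b₂ * d₁) * ha + (a₁ * d₂ - a₂ * d₁) * hb
  have hMK : 2 * (1 + K) ≤ M := by
    rcases hS0.eq_or_lt with h | h
    · have hK0 : 1 + K = 0 := by
        rw [← h, mul_zero] at hMS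
        exact (mul_eq_zero.mp hMS.symm).resolve_left (by linarith)
      have h₁ : a₁ - b₁ = 0 := by nlinarith [sq_nonneg (a₁ - b₁), sq_nonneg (a₂ - b₂)]
      have h₂ : a₂ - b₂ = 0 := by nlinarith [sq_nonneg (a₁ - b₁), sq_nonneg (a₂ - b₂)]
      rw [hK0, hMdef, h₁, h₂]
      simp
    · refine le_of_mul_le_mul_right ?_ h
      rw [hMS]
      nlinarith
  have hlen : d₁ ^ 2 + d₂ ^ 2 + 2 * (1 + K) - 2 * M = 1 := by linarith
  linarith

/-- The relation `0 < x × y` is transitive on an open half-plane. -/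
lemma cross_pos_trans {d₁ d₂ x₁ x₂ y₁ y₂ z₁ z₂ : ℝ}
    (hx : 0 < d₁ * x₂ - d₂ * x₁) (hy : 0 < d₁ * y₂ - d₂ * y₁) (hz : 0 < d₁ * z₂ - d₂ * z₁)
    (hxy : 0 < x₁ * y₂ - x₂ * y₁) (hyz : 0 < y₁ * z₂ - y₂ * z₁) :
    0 < x₁ * z₂ - x₂ * z₁ := by
  refine pos_of_mul_pos_left (b := d₁ * y₂ - d₂ * y₁) ?_ hy.le
  have := add_pos (mul_pos hxy hz) (mul_pos hyz hx)
  linarith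

lemma dist_eq_one_iff_coord (x y : Plane) :
    dist x y = 1 ↔ (x 0 - y 0) ^ 2 + (x 1 - y 1) ^ 2 = 1 := by
  rw [EuclideanSpace.dist_eq, Real.sqrt_eq_one]
  simp [Fin.sum_univ_two, Real.dist_eq, sq_abs]

lemma one_le_dist_iff_coord (x y : Plane) :
    1 ≤ dist x y ↔ 1 ≤ (x 0 - y 0) ^ 2 + (x 1 - y 1) ^ 2 := by
  rw [EuclideanSpace.dist_eq, Real.one_le_sqrt]
  simp [Fin.sum_univ_two, Real.dist_eq, sq_abs]

lemma one_le_dist_opposite_vertices (v : Fin 6 → Plane)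
    (hconv : ∀ i j : Fin 6, j ≠ i → j ≠ i + 1 → ccw (v i) (v (i + 1)) (v j))
    (hunit : ∀ i : Fin 6, dist (v i) (v (i + 1)) = 1) (i : Fin 6) :
    1 ≤ dist (v i) (v (i + 3)) := by
  have hc : ∀ k l : Fin 6, l ≠ k → l ≠ k + 1 → ccw (v (i + k)) (v (i + (k + 1))) (v (i + l)) := by
    intro k l h₁ h₂
    rw [← add_assoc]
    exact hconv _ _ (by simpa using h₁) (by simpa [add_assoc] using h₂)
  have hu : ∀ k : Fin 6, dist (v (i + k)) (v (i + (k + 1))) = 1 := by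
    intro k
    rw [← add_assoc]
    exact hunit _
  simp only [ccw] at hc
  simp only [dist_eq_one_iff_coord] at hu
  rw [one_le_dist_iff_coord, ← add_zero i, add_assoc, zero_add]
  by_contra! hd
  have u0 := hu 0
  have u1 := hu 1
  have u2 := hu 2
  have u3 := hu 3
  have u4 := hu 4
  have u5 := hu 5
  have c012 := hc 0 2 (by decide) (by decide)
  have c013 := hc 0 3 (by decide) (by decide)
  have c231 := hc 2 1 (by decide) (by decide)
  have c230 := hc 2 0 (by decide) (by decide)
  have c345 := hc 3 5 (by decide) (by decide)
  have c340 := hc 3 0 (by decide) (by decide)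
  have c504 := hc 5 4 (by decide) (by decide)
  have c503 := hc 5 3 (by decide) (by decide)
  have c501 := hc 5 1 (by decide) (by decide)
  have c234 := hc 2 4 (by decide) (by decide)
  clear hc hu hconv hunit
  simp only [show (0 + 1 : Fin 6) = 1 from rfl, show (1 + 1 : Fin 6) = 2 from rfl,
    show (2 + 1 : Fin 6) = 3 from rfl, show (3 + 1 : Fin 6) = 4 from rfl,
    show (4 + 1 : Fin 6) = 5 from rfl, show (5 + 1 : Fin 6) = 0 from rfl] at *
  generalize v (i + 0) = p₀ at *
  generalize v (i + 1) = p₁ at *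
  generalize v (i + 2) = p₂ at *
  generalize v (i + 3) = p₃ at *
  generalize v (i + 4) = p₄ at *
  generalize v (i + 5) = p₅ at *
  have lower : 0 < (p₁ 0 - p₀ 0) * (p₂ 1 - p₃ 1) - (p₁ 1 - p₀ 1) * (p₂ 0 - p₃ 0) := by
    apply cross_legs_pos_of_short_base (d₁ := p₃ 0 - p₀ 0) (d₂ := p₃ 1 - p₀ 1) <;> linarith
  have upper : 0 < (p₄ 0 - p₃ 0) * (p₅ 1 - p₀ 1) - (p₄ 1 - p₃ 1) * (p₅ 0 - p₀ 0) := by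
    apply cross_legs_pos_of_short_base (d₁ := p₀ 0 - p₃ 0) (d₂ := p₀ 1 - p₃ 1) <;> linarith
  have cross_side_pos : 0 < (p₀ 0 - p₁ 0) * (p₄ 1 - p₃ 1) - (p₀ 1 - p₁ 1) * (p₄ 0 - p₃ 0) := by
    apply cross_pos_trans (d₁ := p₃ 0 - p₀ 0) (d₂ := p₃ 1 - p₀ 1)
      (y₁ := p₃ 0 - p₂ 0) (y₂ := p₃ 1 - p₂ 1) <;> linarith
  have cross_side_neg : 0 < (p₄ 0 - p₃ 0) * (p₀ 1 - p₁ 1) - (p₄ 1 - p₃ 1) * (p₀ 0 - p₁ 0) := by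
    apply cross_pos_trans (d₁ := p₃ 0 - p₀ 0) (d₂ := p₃ 1 - p₀ 1)
      (y₁ := p₅ 0 - p₀ 0) (y₂ := p₅ 1 - p₀ 1) <;> linarith
  linarith

/-- A convex hexagon with vertices `v 0, …, v 5` in counterclockwise cyclic
order, all of whose sides have length 1, has all three main diagonals of
length at least 1. Strict convexity in counterclockwise order is expressed by
requiring every other vertex to lie strictly to the left of each directed
side; this makes the `v i` pairwise distinct extreme points of the hull. -/
theorem hexagon_main_diagonals_ge_one (v : Fin 6 → Plane)
    (hconv : ∀ i j : Fin 6, j ≠ i → j ≠ i + 1 → ccw (v i) (v (i + 1)) (v j))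
    (hunit : ∀ i : Fin 6, dist (v i) (v (i + 1)) = 1) :
    1 ≤ dist (v 0) (v 3) ∧ 1 ≤ dist (v 1) (v 4) ∧ 1 ≤ dist (v 2) (v 5) := by
  have h := one_le_dist_opposite_vertices v hconv hunit
  exact ⟨h 0, h 1, h 2⟩
end

section
/- Let v₀, v₁, v₂, v₃ be the vertices, in cyclic order, of a convex quadrilateral in the Euclidean plane with dist(v₀, v₁) = dist(v₁, v₂) = dist(v₂, v₃) = 1 and dist(v₀, v₃) < 1. Then the sum of the interior angles of the quadrilateral at the two endpoints of the short side exceeds π: ∠v₃v₀v₁ + ∠v₂v₃v₀ > π. -/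
open EuclideanGeometry

/-- Coordinate form of the key inequality: if `a`, `b`, `w` are unit vectors, `u = a + w - b` is
shorter than `1`, and `u` and `w` lie strictly on the same side of `a + b`, then the projection of
`b` onto `u` exceeds that of `a`. -/
lemma inner_lt_inner_of_short_side {a₀ a₁ b₀ b₁ w₀ w₁ u₀ u₁ : ℝ}
    (h₀ : u₀ = a₀ + w₀ - b₀) (h₁ : u₁ = a₁ + w₁ - b₁)
    (ha : a₀ ^ 2 + a₁ ^ 2 = 1) (hb : b₀ ^ 2 + b₁ ^ 2 = 1) (hw : w₀ ^ 2 + w₁ ^ 2 = 1)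
    (hu : u₀ ^ 2 + u₁ ^ 2 < 1)
    (hus : u₀ * (a₁ + b₁) - u₁ * (a₀ + b₀) < 0)
    (hws : w₀ * (a₁ + b₁) - w₁ * (a₀ + b₀) < 0) :
    u₀ * a₀ + u₁ * a₁ < u₀ * b₀ + u₁ * b₁ := by
  obtain rfl : w₀ = u₀ + b₀ - a₀ := by linarith
  obtain rfl : w₁ = u₁ + b₁ - a₁ := by linarith
  have hs : 0 < (a₀ + b₀) ^ 2 + (a₁ + b₁) ^ 2 := by
    by_contra! h
    have h0 : a₀ + b₀ = 0 := by nlinarith [sq_nonneg (a₀ + b₀), sq_nonneg (a₁ + b₁)]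
    have h1 : a₁ + b₁ = 0 := by nlinarith [sq_nonneg (a₀ + b₀), sq_nonneg (a₁ + b₁)]
    simp [h0, h1] at hus
  have hperp : (b₀ - a₀) * (a₀ + b₀) + (b₁ - a₁) * (a₁ + b₁) = 0 := by linear_combination hb - ha
  have hcross : (b₀ - a₀) * (a₁ + b₁) - (b₁ - a₁) * (a₀ + b₀) < 0 := by
    by_contra! h
    have hpos := mul_pos hs (sub_pos.2 (hw ▸ hu))
    have hnonpos := mul_nonpos_of_nonneg_of_nonpos h (add_neg hus hws).le
    refine hpos.not_ge (le_of_eq_of_le ?_ hnonpos)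
    linear_combination
      ((2 * u₀ + b₀ - a₀) * (a₀ + b₀) + (2 * u₁ + b₁ - a₁) * (a₁ + b₁)) * hperp
  have hpos := mul_pos_of_neg_of_neg hus hcross
  have key : 0 < ((a₀ + b₀) ^ 2 + (a₁ + b₁) ^ 2) * (u₀ * (b₀ - a₀) + u₁ * (b₁ - a₁)) := by
    refine hpos.trans_eq ?_
    linear_combination -(u₀ * (a₀ + b₀) + u₁ * (a₁ + b₁)) * hperp
  linarith [pos_of_mul_pos_right key hs.le]

/-- Among unit vectors, a smaller inner product with `u` means a larger angle with `u`. -/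
lemma angle_lt_angle_of_inner_lt {V : Type*} [NormedAddCommGroup V] [InnerProductSpace ℝ V]
    {u a b : V} (ha : ‖a‖ = 1) (hb : ‖b‖ = 1) (h : inner ℝ u a < inner ℝ u b) :
    InnerProductGeometry.angle u b < InnerProductGeometry.angle u a := by
  by_contra! hle
  have hcos := Real.cos_le_cos_of_nonneg_of_le_pi (InnerProductGeometry.angle_nonneg u a)
    (InnerProductGeometry.angle_le_pi u b) hle
  rw [← InnerProductGeometry.cos_angle_mul_norm_mul_norm u a,
    ← InnerProductGeometry.cos_angle_mul_norm_mul_norm u b, ha, hb] at h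
  exact h.not_ge (mul_le_mul_of_nonneg_right hcos (by positivity))

/-- If `v 0, v 1, v 2, v 3` are the vertices, in counterclockwise cyclic
order, of a convex quadrilateral in the plane with three consecutive sides of
length 1 and the fourth side of length less than 1, then the two interior
angles at the endpoints of the short side sum to more than `π`. -/
theorem quadrilateral_short_side_angles (v : Fin 4 → EuclideanSpace ℝ (Fin 2))
    (hconv : ∀ i j : Fin 4, j ≠ i → j ≠ i + 1 → ccw (v i) (v (i + 1)) (v j))
    (h01 : dist (v 0) (v 1) = 1) (h12 : dist (v 1) (v 2) = 1)
    (h23 : dist (v 2) (v 3) = 1) (h03 : dist (v 0) (v 3) < 1) :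
    ∠ (v 3) (v 0) (v 1) + ∠ (v 2) (v 3) (v 0) > Real.pi := by
  have c120 : ccw (v 1) (v 2) (v 0) := hconv 1 0 (by decide) (by decide)
  have c123 : ccw (v 1) (v 2) (v 3) := hconv 1 3 (by decide) (by decide)
  have c301 : ccw (v 3) (v 0) (v 1) := hconv 3 1 (by decide) (by decide)
  have c302 : ccw (v 3) (v 0) (v 2) := hconv 3 2 (by decide) (by decide)
  have hlt : InnerProductGeometry.angle (v 3 - v 0) (v 2 - v 3) <
      InnerProductGeometry.angle (v 3 - v 0) (v 1 - v 0) := by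
    refine angle_lt_angle_of_inner_lt (by rw [← dist_eq_norm, dist_comm, h01])
      (by rw [← dist_eq_norm, h23]) ?_
    rw [EuclideanSpace.dist_eq, Real.sqrt_eq_one] at h01 h12 h23
    rw [EuclideanSpace.dist_eq, Real.sqrt_lt' one_pos] at h03
    simp only [Fin.sum_univ_two, Real.dist_eq, sq_abs] at h01 h12 h23 h03
    have := inner_lt_inner_of_short_side
      (a₀ := v 1 0 - v 0 0) (a₁ := v 1 1 - v 0 1) (b₀ := v 2 0 - v 3 0) (b₁ := v 2 1 - v 3 1)
      (w₀ := v 2 0 - v 1 0) (w₁ := v 2 1 - v 1 1) (u₀ := v 3 0 - v 0 0) (u₁ := v 3 1 - v 0 1)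
      (by ring) (by ring) (by linarith) (by linarith) (by linarith) (by linarith)
      (by unfold ccw at c301 c302; linarith) (by unfold ccw at c120 c123; linarith)
    simp only [PiLp.inner_apply, Fin.sum_univ_two, PiLp.sub_apply, RCLike.inner_apply, conj_trivial]
    linarith
  have hangle : ∠ (v 2) (v 3) (v 0) =
      Real.pi - InnerProductGeometry.angle (v 3 - v 0) (v 2 - v 3) := by
    rw [InnerProductGeometry.angle_comm, ← InnerProductGeometry.angle_neg_right, neg_sub]
    rfl
  have hangle' : ∠ (v 3) (v 0) (v 1) =
      InnerProductGeometry.angle (v 3 - v 0) (v 1 - v 0) := rfl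
  rw [hangle, hangle']
  linarith
end

section
/- Let α₀, α₁, α₂, α₃, α₄, α₅ be real numbers with α₀ + α₁ + α₂ + α₃ + α₄ + α₅ = 4π, and suppose every pair αᵢ, αⱼ with i ≠ j is linearly independent over ℚ. Define the three multisets of curvatures M₀₃ = {π − α₀/2, π − α₃/2, 2π − (α₁ + α₅), 2π − (α₂ + α₄)}, M₁₄ = {π − α₁/2, π − α₄/2, 2π − (α₀ + α₂), 2π − (α₃ + α₅)}, and M₂₅ = {π − α₂/2, π − α₅/2, 2π − (α₀ + α₁), 2π − (α₃ + α₄)}. Then M₀₃, M₁₄, M₂₅ are pairwise distinct as multisets. -/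
/-- Two real numbers `x` and `y` are linearly independent over `ℚ` if there
are no rational numbers `a`, `b` with `y = a * π + b * x`. -/
def LinIndepQ (x y : ℝ) : Prop :=
  ¬ ∃ a b : ℚ, y = (a : ℝ) * Real.pi + (b : ℝ) * x

theorem LinIndepQ.ne {x y : ℝ} (h : LinIndepQ x y) : y ≠ x :=
  fun e => h ⟨0, 1, by simp [e]⟩

theorem LinIndepQ.add_ne {x y : ℝ} (h : LinIndepQ x y) : x + y ≠ Real.pi + x / 2 :=
  fun e => h ⟨1, -1 / 2, by push_cast; linarith⟩

/-- A vertex curvature `π - x / 2` of one folding that is also a curvature of another folding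
is, if the folded angles `u`, `v` differ from `x`, the curvature of a glued pair of vertices. -/
theorem add_eq_or_add_eq_of_curvature_mem {x u v s t : ℝ} {M : Multiset ℝ}
    (hM : M = {Real.pi - u / 2, Real.pi - v / 2, 2 * Real.pi - s, 2 * Real.pi - t})
    (hx : Real.pi - x / 2 ∈ M) (hu : LinIndepQ x u) (hv : LinIndepQ x v) :
    s = Real.pi + x / 2 ∨ t = Real.pi + x / 2 := by
  simp only [hM, Multiset.insert_eq_cons, Multiset.mem_cons, Multiset.mem_singleton] at hx
  rcases hx with e | e | e | e
  · exact absurd (by linarith) hu.ne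
  · exact absurd (by linarith) hv.ne
  · exact Or.inl (by linarith)
  · exact Or.inr (by linarith)

/-- If `α 0, …, α 5` sum to `4π` and every pair of them (with distinct
indices) is linearly independent over `ℚ`, then the three multisets of vertex
curvatures of the three perimeter-halving tetrahedra are pairwise distinct. -/
theorem curvature_multisets_pairwise_distinct (α : Fin 6 → ℝ)
    (hsum : α 0 + α 1 + α 2 + α 3 + α 4 + α 5 = 4 * Real.pi)
    (hindep : ∀ i j : Fin 6, i ≠ j → LinIndepQ (α i) (α j)) :
    let M03 : Multiset ℝ :=
      {Real.pi - α 0 / 2, Real.pi - α 3 / 2,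
        2 * Real.pi - (α 1 + α 5), 2 * Real.pi - (α 2 + α 4)}
    let M14 : Multiset ℝ :=
      {Real.pi - α 1 / 2, Real.pi - α 4 / 2,
        2 * Real.pi - (α 0 + α 2), 2 * Real.pi - (α 3 + α 5)}
    let M25 : Multiset ℝ :=
      {Real.pi - α 2 / 2, Real.pi - α 5 / 2,
        2 * Real.pi - (α 0 + α 1), 2 * Real.pi - (α 3 + α 4)}
    M03 ≠ M14 ∧ M03 ≠ M25 ∧ M14 ≠ M25 := by
  intro M03 M14 M25
  refine ⟨fun h => ?_, fun h => ?_, fun h => ?_⟩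
  · have h0 : α 3 + α 5 = Real.pi + α 0 / 2 :=
      (add_eq_or_add_eq_of_curvature_mem h (by simp [M03]) (hindep 0 1 (by decide))
        (hindep 0 4 (by decide))).resolve_left (hindep 0 2 (by decide)).add_ne
    have h3 : α 0 + α 2 = Real.pi + α 3 / 2 :=
      (add_eq_or_add_eq_of_curvature_mem h (by simp [M03]) (hindep 3 1 (by decide))
        (hindep 3 4 (by decide))).resolve_right (hindep 3 5 (by decide)).add_ne
    have h1 : α 2 + α 4 = Real.pi + α 1 / 2 :=
      (add_eq_or_add_eq_of_curvature_mem h.symm (by simp [M14]) (hindep 1 0 (by decide))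
        (hindep 1 3 (by decide))).resolve_left (hindep 1 5 (by decide)).add_ne
    have h4 : α 1 + α 5 = Real.pi + α 4 / 2 :=
      (add_eq_or_add_eq_of_curvature_mem h.symm (by simp [M14]) (hindep 4 0 (by decide))
        (hindep 4 3 (by decide))).resolve_right
          (fun e => (hindep 4 2 (by decide)).add_ne ((add_comm _ _).trans e))
    exact hindep 0 1 (by decide) ⟨4 / 3, -1, by push_cast; linarith⟩
  · have h0 : α 3 + α 4 = Real.pi + α 0 / 2 :=
      (add_eq_or_add_eq_of_curvature_mem h (by simp [M03]) (hindep 0 2 (by decide))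
        (hindep 0 5 (by decide))).resolve_left (hindep 0 1 (by decide)).add_ne
    have h3 : α 0 + α 1 = Real.pi + α 3 / 2 :=
      (add_eq_or_add_eq_of_curvature_mem h (by simp [M03]) (hindep 3 2 (by decide))
        (hindep 3 5 (by decide))).resolve_right (hindep 3 4 (by decide)).add_ne
    have h2 : α 1 + α 5 = Real.pi + α 2 / 2 :=
      (add_eq_or_add_eq_of_curvature_mem h.symm (by simp [M25]) (hindep 2 0 (by decide))
        (hindep 2 3 (by decide))).resolve_right (hindep 2 4 (by decide)).add_ne
    have h5 : α 2 + α 4 = Real.pi + α 5 / 2 :=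
      (add_eq_or_add_eq_of_curvature_mem h.symm (by simp [M25]) (hindep 5 0 (by decide))
        (hindep 5 3 (by decide))).resolve_left
          (fun e => (hindep 5 1 (by decide)).add_ne ((add_comm _ _).trans e))
    exact hindep 0 1 (by decide) ⟨5 / 3, -3 / 2, by push_cast; linarith⟩
  · have h1 : α 3 + α 4 = Real.pi + α 1 / 2 :=
      (add_eq_or_add_eq_of_curvature_mem h (by simp [M14]) (hindep 1 2 (by decide))
        (hindep 1 5 (by decide))).resolve_left
          (fun e => (hindep 1 0 (by decide)).add_ne ((add_comm _ _).trans e))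
    have h4 : α 0 + α 1 = Real.pi + α 4 / 2 :=
      (add_eq_or_add_eq_of_curvature_mem h (by simp [M14]) (hindep 4 2 (by decide))
        (hindep 4 5 (by decide))).resolve_right
          (fun e => (hindep 4 3 (by decide)).add_ne ((add_comm _ _).trans e))
    have h2 : α 3 + α 5 = Real.pi + α 2 / 2 :=
      (add_eq_or_add_eq_of_curvature_mem h.symm (by simp [M25]) (hindep 2 1 (by decide))
        (hindep 2 4 (by decide))).resolve_left
          (fun e => (hindep 2 0 (by decide)).add_ne ((add_comm _ _).trans e))
    have h5 : α 0 + α 2 = Real.pi + α 5 / 2 :=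
      (add_eq_or_add_eq_of_curvature_mem h.symm (by simp [M25]) (hindep 5 1 (by decide))
        (hindep 5 4 (by decide))).resolve_right
          (fun e => (hindep 5 3 (by decide)).add_ne ((add_comm _ _).trans e))
    exact hindep 0 1 (by decide) ⟨10 / 9, -2 / 3, by push_cast; linarith⟩
end
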